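/- For every f ∈ L¹(ℍⁿ), every k ∈ ℕ, every λ ≠ 0 and every z ∈ ℂⁿ, with a = (λ,(2k+n)|λ|), the Strichartz Fourier transform satisfies the compatibility identity (2π)^{−n} |λ|^n ∫_{ℂⁿ} f̂(a,w) φ_{k,λ}(z−w) e^{(i/2)λ Im(z·w̄)} dw = f̂(a,z). -/

import Mathlib

open MeasureTheory Complex Real Filter

noncomputable section

/-- ℂⁿ with its Euclidean (Hilbert space) structure. -/
abbrev Cn (n : ℕ) := EuclideanSpace ℂ (Fin n)

instance (n : ℕ) : MeasurableSpace (Cn n) := borel _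
instance (n : ℕ) : BorelSpace (Cn n) := ⟨rfl⟩
instance (n : ℕ) : InnerProductSpace ℝ (Cn n) := InnerProductSpace.rclikeToReal ℂ (Cn n)

/-- The Heisenberg group ℍⁿ = ℂⁿ × ℝ (as a measure space with Lebesgue/Haar measure). -/
abbrev Hn (n : ℕ) := Cn n × ℝ

/-- Im (z · w̄) = Im (∑ⱼ zⱼ conj wⱼ). -/
def imZW {n : ℕ} (z w : Cn n) : ℝ := (∑ j, z j * (starRingEnd ℂ) (w j)).im

/-- The λ-twisted convolution F ∗_λ G (z) = ∫ F(z−w) G(w) e^{(i/2)λ Im(z·w̄)} dw. -/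
def twConv (n : ℕ) (lam : ℝ) (F G : Cn n → ℂ) (z : Cn n) : ℂ :=
  ∫ w : Cn n, F (z - w) * G w * Complex.exp
    (Complex.I / 2 * (lam : ℂ) * ((imZW z w : ℝ) : ℂ))

/-- The inverse Fourier transform in the central variable, f^λ(z) = ∫ e^{iλt} f(z,t) dt. -/
def fLam (n : ℕ) (f : Hn n → ℂ) (lam : ℝ) (z : Cn n) : ℂ :=
  ∫ t : ℝ, Complex.exp (Complex.I * (lam : ℂ) * (t : ℂ)) * f (z, t)

/-- The Laguerre polynomial of type m−1:
L_k^{m−1}(t) = ∑_{j=0}^k binom(k+m−1, k−j) (−t)^j / j!. -/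
def lagPoly (m k : ℕ) (t : ℝ) : ℝ :=
  ∑ j ∈ Finset.range (k + 1), ((k + m - 1).choose (k - j) : ℝ) * (-t) ^ j / (Nat.factorial j)

/-- The Laguerre function φ_{k,λ}^{m−1}(z) = L_k^{m−1}(|λ||z|²/2) e^{−|λ||z|²/4} on ℂ^m. -/
def lagFun (m k : ℕ) (lam : ℝ) (z : Cn m) : ℝ :=
  lagPoly m k (|lam| * ‖z‖ ^ 2 / 2) * Real.exp (-(|lam| * ‖z‖ ^ 2 / 4))

/-- The Strichartz Fourier transform f̂(a,z) = f^{−λ} ∗_{−λ} φ_{k,λ}(z)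
at the point a = (λ, (2k+n)|λ|) of the ray R_k. -/
def stri (n : ℕ) (f : Hn n → ℂ) (k : ℕ) (lam : ℝ) (z : Cn n) : ℂ :=
  twConv n (-lam) (fLam n f (-lam)) (fun w => ((lagFun n k lam w : ℝ) : ℂ)) z

/-- The normalizing constant k!(n−1)!/(k+n−1)!. -/
def normC (n k : ℕ) : ℝ :=
  (Nat.factorial k * Nat.factorial (n - 1) : ℝ) / (Nat.factorial (k + n - 1))

/-- The Bessel kernel J_{n−1}(s)/s^{n−1}, extended by its limiting value
1/(2^{n−1}(n−1)!) at s = 0, given by its power series. -/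
def besselKer (n : ℕ) (s : ℝ) : ℝ :=
  ∑' m : ℕ, (-1 : ℝ) ^ m / (Nat.factorial m * Nat.factorial (m + n - 1)) *
    s ^ (2 * m) / 2 ^ (2 * m + n - 1)

/-- The Strichartz Fourier transform f̂((0,τ),z) on the limiting ray R_∞. -/
def striLim (n : ℕ) (f : Hn n → ℂ) (z : Cn n) (τ : ℝ) : ℂ :=
  ((Nat.factorial (n - 1) * 2 ^ (n - 1) : ℝ) : ℂ) *
    ∫ w : Cn n, fLam n f 0 (z - w) * ((besselKer n (Real.sqrt τ * ‖w‖) : ℝ) : ℂ)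

/-- The Heisenberg fan Ω ⊆ ℝ²: union of the rays R_k, k ∈ ℕ, and the limiting ray R_∞. -/
def fan (n : ℕ) : Set (ℝ × ℝ) :=
  {a | (∃ k : ℕ, a.1 ≠ 0 ∧ a.2 = (2 * k + n) * |a.1|) ∨ (a.1 = 0 ∧ 0 ≤ a.2)}

open scoped Classical in
/-- The index k of the ray R_k through a point of the fan (junk value otherwise). -/
def fanK (n : ℕ) (a : ℝ × ℝ) : ℕ :=
  if h : ∃ k : ℕ, a.2 = (2 * k + n) * |a.1| then h.choose else 0

/-- The normalized Strichartz Fourier transform f̃(a,z), as a function of a ∈ Ω. -/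
def striNorm (n : ℕ) (f : Hn n → ℂ) (z : Cn n) (a : ℝ × ℝ) : ℂ :=
  if a.1 = 0 then striLim n f z a.2
  else ((normC n (fanK n a) : ℝ) : ℂ) * stri n f (fanK n a) a.1 z

/-- The Plancherel measure ν on the Heisenberg fan:
∫ φ dν = (2π)^{−2n−1} ∫_ℝ (∑_k φ(λ,(2k+n)|λ|)) |λ|^{2n} dλ. -/
def fanMeasure (n : ℕ) : Measure (ℝ × ℝ) :=
  (ENNReal.ofReal ((2 * π) ^ (2 * n + 1)))⁻¹ •
    Measure.sum (fun k : ℕ =>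
      Measure.map (fun lam : ℝ => (lam, (2 * k + n) * |lam|))
        (volume.withDensity fun lam => ENNReal.ofReal (|lam| ^ (2 * n))))

/-- A function on ℍⁿ is radial if it is invariant under the action of the unitary group U(n). -/
def IsRadial (n : ℕ) (g : Hn n → ℂ) : Prop :=
  ∀ (U : Cn n ≃ₗᵢ[ℂ] Cn n) (x : Hn n), g (U x.1, x.2) = g x

/-- The k-th Laguerre coefficient R_k(λ, f) = (k!(n−1)!/(k+n−1)!) ∫ f^λ(w) φ_{k,λ}(w) dw. -/
def lagCoef (n : ℕ) (k : ℕ) (lam : ℝ) (f : Hn n → ℂ) : ℂ :=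
  ((normC n k : ℝ) : ℂ) * ∫ w : Cn n, fLam n f lam w * ((lagFun n k lam w : ℝ) : ℂ)

/-- The Gelfand (spherical Fourier) transform of a radial function on ℍ^m, evaluated at
(λ, (2j+m)|λ|). -/
def gelfand (m : ℕ) (h : Hn m → ℂ) (lam : ℝ) (j : ℕ) : ℂ :=
  ((normC m j : ℝ) : ℂ) *
    ∫ x : Hn m, h x * Complex.exp (Complex.I * (lam : ℂ) * (x.2 : ℂ)) *
      ((lagFun m j lam x.1 : ℝ) : ℂ)

/-- The group convolution on ℍⁿ: f∗g(x) = ∫ f(x·y⁻¹) g(y) dy. -/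
def hConv (n : ℕ) (f g : Hn n → ℂ) (x : Hn n) : ℂ :=
  ∫ y : Hn n, f (x.1 - y.1, x.2 - y.2 - imZW x.1 y.1 / 2) * g y

/-- P is a bigraded solid harmonic of degree (p,q) on ℂⁿ: P(z) = ∑_{|α|=p,|β|=q} c_{αβ} z^α z̄^β,
harmonic as a function on ℝ^{2n} (the harmonicity Δ P = 0 is expressed by the equivalent
algebraic condition on the coefficients). -/
def IsBigradedSolidHarmonic (n p q : ℕ) (P : Cn n → ℂ) : Prop :=
  ∃ c : (Fin n → ℕ) → (Fin n → ℕ) → ℂ,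
    (∀ z : Cn n, P z =
      ∑ α ∈ Finset.Nat.antidiagonalTuple n p, ∑ β ∈ Finset.Nat.antidiagonalTuple n q,
        c α β * (∏ j, z j ^ α j) * ∏ j, (starRingEnd ℂ) (z j) ^ β j) ∧
    (∀ γ δ : Fin n → ℕ,
      ∑ j : Fin n, (((γ j + 1) * (δ j + 1) : ℕ) : ℂ) *
        c (Function.update γ j (γ j + 1)) (Function.update δ j (δ j + 1)) = 0)

/-- The physicists' Hermite polynomial H_m(x) = (−1)^m e^{x²} (d/dx)^m e^{−x²}. -/
def physHermite (m : ℕ) (x : ℝ) : ℝ :=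
  (-1 : ℝ) ^ m * Real.exp (x ^ 2) * iteratedDeriv m (fun y => Real.exp (-(y ^ 2))) x

/-- The normalized Hermite function h_m(x) = (2^m m! √π)^{−1/2} H_m(x) e^{−x²/2}. -/
def hermiteFun (m : ℕ) (x : ℝ) : ℝ :=
  (Real.sqrt (2 ^ m * (Nat.factorial m) * Real.sqrt π))⁻¹ * physHermite m x *
    Real.exp (-(x ^ 2) / 2)

/-- The scaled Hermite function Φ_α^λ(x) = |λ|^{n/4} ∏ⱼ h_{αⱼ}(√|λ| xⱼ). -/
def scaledHermite (n : ℕ) (lam : ℝ) (α : Fin n → ℕ) (x : Fin n → ℝ) : ℝ :=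
  |lam| ^ ((n : ℝ) / 4) * ∏ j, hermiteFun (α j) (Real.sqrt |lam| * x j)

/-- The Schrödinger representation: π_λ(z,t)φ(ξ) = e^{iλt} e^{iλ(x·ξ+(1/2)x·y)} φ(ξ+y),
z = x+iy. -/
def schrodinger (n : ℕ) (lam : ℝ) (zt : Hn n) (φ : (Fin n → ℝ) → ℂ) (ξ : Fin n → ℝ) : ℂ :=
  Complex.exp (Complex.I * (lam : ℂ) * (zt.2 : ℂ)) *
    Complex.exp (Complex.I * (lam : ℂ) *
      (((∑ j, (zt.1 j).re * ξ j) + (∑ j, (zt.1 j).re * (zt.1 j).im) / 2 : ℝ) : ℂ)) *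
    φ (fun j => ξ j + (zt.1 j).im)

/-- The group Fourier transform f̂(λ)φ = ∫ f(z,t) π_λ(z,t)φ dz dt. -/
def groupFT (n : ℕ) (f : Hn n → ℂ) (lam : ℝ) (φ : (Fin n → ℝ) → ℂ) (ξ : Fin n → ℝ) : ℂ :=
  ∫ x : Hn n, f x * schrodinger n lam x φ ξ

lemma hasSum_lagPoly {n : ℕ} (hn : 1 ≤ n) {r : ℝ} (hr : |r| < 1) (t : ℝ) :
    HasSum (fun k : ℕ => r ^ k * lagPoly n k t)
      (((1 - r) ^ n)⁻¹ * Real.exp (-(r * t / (1 - r)))) := by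
  set F : ℕ × ℕ → ℝ := fun p =>
    (-(r * t)) ^ p.1 / p.1.factorial *
      (((p.2 + (p.1 + n - 1)).choose (p.1 + n - 1) : ℝ) * r ^ p.2) with hF
  have key : ∀ (x q : ℝ), |q| < 1 → ∀ j : ℕ, HasSum (fun m : ℕ => x ^ j / j.factorial *
      (((m + (j + n - 1)).choose (j + n - 1) : ℝ) * q ^ m))
      (((1 - q) ^ n)⁻¹ * ((x / (1 - q)) ^ j / j.factorial)) := by
    intro x q hq j
    have h1 : 1 - q ≠ 0 := by have := (abs_lt.1 hq).2; linarith
    have h := (hasSum_choose_mul_geometric_of_norm_lt_one (j + n - 1)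
      (show ‖q‖ < 1 by simpa using hq)).mul_left (x ^ j / j.factorial)
    rw [show j + n - 1 + 1 = j + n by omega] at h
    have e : x ^ j / j.factorial * (1 / (1 - q) ^ (j + n)) =
        ((1 - q) ^ n)⁻¹ * ((x / (1 - q)) ^ j / j.factorial) := by
      rw [div_pow, pow_add]
      field_simp
    exact e ▸ h
  have hexp : ∀ x q : ℝ, HasSum (fun j : ℕ => ((1 - q) ^ n)⁻¹ * ((x / (1 - q)) ^ j / j.factorial))
      (((1 - q) ^ n)⁻¹ * Real.exp (x / (1 - q))) := by
    intro x q
    have := NormedSpace.expSeries_div_hasSum_exp (x / (1 - q))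
    rw [← Real.exp_eq_exp_ℝ] at this
    exact this.mul_left _
  have hr' : |(|r|)| < 1 := by simpa using hr
  have hsum : Summable F := by
    refine Summable.of_norm ?_
    have hn' : (fun p => ‖F p‖) = fun p : ℕ × ℕ => |r * t| ^ p.1 / p.1.factorial *
      (((p.2 + (p.1 + n - 1)).choose (p.1 + n - 1) : ℝ) * |r| ^ p.2) := by
      ext p; simp [hF, abs_mul]
    rw [hn', summable_prod_of_nonneg (fun p => by positivity)]
    refine ⟨fun j => (key _ _ hr' j).summable, ?_⟩
    simp only [(key _ _ hr' _).tsum_eq]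
    exact (hexp _ _).summable
  have hval : HasSum F (((1 - r) ^ n)⁻¹ * Real.exp (-(r * t / (1 - r)))) := by
    have h := hsum.hasSum.prod_fiberwise (fun j => key (-(r * t)) r hr j)
    have h2 := h.unique (hexp (-(r * t)) r)
    rw [← neg_div, ← h2]
    exact hsum.hasSum
  have h3 := (Finset.HasAntidiagonal.sigmaAntidiagonalEquivProd.hasSum_iff.2 hval).sigma
    (fun k => (hasSum_fintype _))
  have h4 : ∀ k : ℕ, r ^ k * lagPoly n k t = ∑ c : Finset.HasAntidiagonal.antidiagonal k, F c := by
    intro k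
    rw [Finset.sum_coe_sort (Finset.HasAntidiagonal.antidiagonal k) F,
      Finset.Nat.sum_antidiagonal_eq_sum_range_succ_mk, lagPoly, Finset.mul_sum]
    refine Finset.sum_congr rfl fun j hj => ?_
    obtain ⟨m, rfl⟩ := Nat.exists_eq_add_of_le (Nat.lt_succ_iff.1 (Finset.mem_range.1 hj))
    have hc : (m + (j + n - 1)).choose (j + n - 1) = (j + m + n - 1).choose m := by
      rw [show j + m + n - 1 = m + (j + n - 1) by omega, Nat.choose_symm_add]
    simp only [hF, Nat.add_sub_cancel_left, hc]
    rw [← mul_neg, mul_pow, pow_add]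
    ring
  simp only [h4]
  exact h3

lemma eq_of_hasSum_pow_mul {a b : ℕ → ℂ} {S : ℝ → ℂ} {ρ : ℝ} (hρ : 0 < ρ)
    (ha : ∀ r : ℝ, |r| < ρ → HasSum (fun k => (r : ℂ) ^ k * a k) (S r))
    (hb : ∀ r : ℝ, |r| < ρ → HasSum (fun k => (r : ℂ) ^ k * b k) (S r)) : a = b := by
  let p : (ℕ → ℂ) → FormalMultilinearSeries ℝ ℝ ℂ :=
    fun c k => ContinuousMultilinearMap.mkPiRing ℝ (Fin k) (c k)
  have key : ∀ c : ℕ → ℂ, (∀ r : ℝ, |r| < ρ → HasSum (fun k => (r : ℂ) ^ k * c k) (S r)) →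
      HasFPowerSeriesAt S (p c) 0 := by
    intro c hc
    refine hasFPowerSeriesAt_iff.2 ?_
    filter_upwards [Metric.ball_mem_nhds (0 : ℝ) hρ] with r hr
    have := hc r (by simpa using hr)
    simpa [p, FormalMultilinearSeries.coeff] using this
  have h := (key a ha).eq_formalMultilinearSeries (key b hb)
  ext k
  have := congrArg (fun p => FormalMultilinearSeries.coeff p k) h
  simpa [p, FormalMultilinearSeries.coeff] using this

lemma abs_lagPoly_le (n k : ℕ) (t : ℝ) : |lagPoly n k t| ≤ lagPoly n k (-|t|) := by
  unfold lagPoly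
  refine (Finset.abs_sum_le_sum_abs _ _).trans (le_of_eq ?_)
  refine Finset.sum_congr rfl fun j _ => ?_
  simp [abs_div, abs_mul]

lemma continuous_lagFun (n k : ℕ) (lam : ℝ) : Continuous (lagFun n k lam) := by
  unfold lagFun lagPoly
  fun_prop

lemma imZW_eq_inner {n : ℕ} (z w : Cn n) : imZW z w = inner ℝ ((-I : ℂ) • z) w := by
  rw [real_inner_comm, show (inner ℝ w ((-I : ℂ) • z)) = (inner ℂ w ((-I : ℂ) • z)).re from rfl,
    inner_smul_right]
  simp [imZW, PiLp.inner_apply]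

lemma imZW_self {n : ℕ} (z : Cn n) : imZW z z = 0 := by
  simp [imZW, Complex.mul_conj]

lemma imZW_swap {n : ℕ} (z w : Cn n) : imZW w z = -imZW z w := by
  simp only [imZW, Complex.im_sum, ← Finset.sum_neg_distrib]
  refine Finset.sum_congr rfl fun j _ => ?_
  simp; ring

lemma imZW_add_right {n : ℕ} (z u w : Cn n) : imZW z (u + w) = imZW z u + imZW z w := by
  simp only [imZW_eq_inner, inner_add_right]

lemma imZW_add_left {n : ℕ} (z u w : Cn n) : imZW (z + u) w = imZW z w + imZW u w := by
  simp only [imZW_eq_inner, smul_add, inner_add_left]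

lemma imZW_sub_right {n : ℕ} (z u w : Cn n) : imZW z (u - w) = imZW z u - imZW z w := by
  simp only [imZW_eq_inner, inner_sub_right]

lemma imZW_sub_left {n : ℕ} (z u w : Cn n) : imZW (z - u) w = imZW z w - imZW u w := by
  simp only [imZW_eq_inner, smul_sub, inner_sub_left]

/-- The unimodular factor of the twisted convolution. -/
def twPhase {n : ℕ} (μ : ℝ) (z w : Cn n) : ℂ :=
  cexp (I / 2 * (μ : ℂ) * (imZW z w : ℂ))

lemma continuous_twPhase {X : Type*} [TopologicalSpace X] {n : ℕ} (μ : ℝ) {f g : X → Cn n}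
    (hf : Continuous f) (hg : Continuous g) : Continuous fun x => twPhase μ (f x) (g x) := by
  simp only [twPhase, imZW_eq_inner]
  fun_prop

lemma norm_twPhase {n : ℕ} (μ : ℝ) (z w : Cn n) : ‖twPhase μ z w‖ = 1 := by
  rw [twPhase, show I / 2 * (μ : ℂ) * (imZW z w : ℂ) = ((μ * imZW z w / 2 : ℝ) : ℂ) * I by
    push_cast; ring, Complex.norm_exp_ofReal_mul_I]

lemma twConv_eq {n : ℕ} (μ : ℝ) (F G : Cn n → ℂ) (z : Cn n) :
    twConv n μ F G z = ∫ w, F (z - w) * G w * twPhase μ z w := rfl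

lemma twConv_comm {n : ℕ} (μ : ℝ) (F G : Cn n → ℂ) (z : Cn n) :
    twConv n μ F G z = twConv n (-μ) G F z := by
  rw [twConv_eq, twConv_eq, ← integral_sub_left_eq_self _ _ z]
  refine integral_congr_ae (Eventually.of_forall fun w => ?_)
  simp only [twPhase, sub_sub_cancel, imZW_sub_right, imZW_self]
  rw [mul_comm (F w)]
  push_cast
  congr 2
  ring

lemma twConv_gaussian {n : ℕ} {a b : ℝ} (hab : 0 < a + b) (μ : ℝ) (z : Cn n) :
    twConv n μ (fun w => (Real.exp (-(a * ‖w‖ ^ 2)) : ℂ))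
        (fun w => (Real.exp (-(b * ‖w‖ ^ 2)) : ℂ)) z =
      ((π / (a + b)) ^ n * Real.exp (-((a * b + μ ^ 2 / 16) / (a + b) * ‖z‖ ^ 2)) : ℝ) := by
  have hab' : a + b ≠ 0 := hab.ne'
  have habc : (a : ℂ) + b ≠ 0 := by exact_mod_cast hab'
  rw [twConv_eq, ← integral_add_right_eq_self _ ((a / (a + b)) • z)]
  have h : ∀ w : Cn n,
      (Real.exp (-(a * ‖z - (w + (a / (a + b)) • z)‖ ^ 2)) : ℂ) *
        (Real.exp (-(b * ‖w + (a / (a + b)) • z‖ ^ 2)) : ℂ) *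
        twPhase μ z (w + (a / (a + b)) • z) =
      cexp (-(a * b / (a + b) * ‖z‖ ^ 2 : ℝ)) *
        cexp (-((a + b : ℝ) : ℂ) * ‖w‖ ^ 2 + (I / 2 * μ) * (inner ℝ ((-I : ℂ) • z) w : ℝ)) := by
    intro w
    have e1 : ‖z - (w + (a / (a + b)) • z)‖ ^ 2 =
        (b / (a + b)) ^ 2 * ‖z‖ ^ 2 - 2 * (b / (a + b)) * inner ℝ z w + ‖w‖ ^ 2 := by
      have : z - (w + (a / (a + b)) • z) = (b / (a + b)) • z - w := by
        have : b / (a + b) = 1 - a / (a + b) := by field_simp; ring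
        rw [this]; module
      rw [this, norm_sub_sq_real, norm_smul, real_inner_smul_left, mul_pow, norm_eq_abs, sq_abs]
      ring
    have e2 : ‖w + (a / (a + b)) • z‖ ^ 2 =
        (a / (a + b)) ^ 2 * ‖z‖ ^ 2 + 2 * (a / (a + b)) * inner ℝ z w + ‖w‖ ^ 2 := by
      rw [norm_add_sq_real, norm_smul, real_inner_smul_right, mul_pow, norm_eq_abs, sq_abs,
        real_inner_comm]
      ring
    have e3 : imZW z (w + (a / (a + b)) • z) = inner ℝ ((-I : ℂ) • z) w := by
      have h0 := imZW_self z
      rw [imZW_eq_inner] at h0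
      rw [imZW_eq_inner, inner_add_right, real_inner_smul_right, h0]
      simp
    rw [e1, e2, twPhase, e3, Complex.ofReal_exp, Complex.ofReal_exp, ← Complex.exp_add,
      ← Complex.exp_add, ← Complex.exp_add]
    congr 1
    push_cast
    field_simp
    ring
  simp only [h]
  rw [integral_const_mul, GaussianFourier.integral_cexp_neg_mul_sq_norm_add (by simpa using hab),
    show Module.finrank ℝ (Cn n) = 2 * n by rw [← Module.finrank_mul_finrank ℝ ℂ]; simp]
  have e4 : ((2 * n : ℕ) : ℂ) / 2 = (n : ℂ) := by push_cast; ring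
  rw [e4, Complex.cpow_natCast, mul_left_comm, ← Complex.exp_add, norm_smul]
  push_cast
  congr 2
  simp only [norm_neg, Complex.norm_I, Complex.ofReal_one, mul_pow, div_pow, I_sq]
  field_simp
  ring

lemma one_sub_pos_of_abs_lt_quarter {r : ℝ} (hr : |r| < 1 / 4) : 0 < 1 - r := by
  have := (abs_lt.1 hr).2
  linarith

/-- The generating function `∑ₖ rᵏ φ_{k,λ}` of the Laguerre functions in closed form. -/
def lagGen (n : ℕ) (r lam : ℝ) (z : Cn n) : ℝ :=
  ((1 - r) ^ n)⁻¹ * Real.exp (-((1 + r) / (1 - r) * (|lam| / 4) * ‖z‖ ^ 2))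

lemma hasSum_lagFun {n : ℕ} (hn : 1 ≤ n) {r : ℝ} (hr : |r| < 1) (lam : ℝ) (z : Cn n) :
    HasSum (fun k : ℕ => r ^ k * lagFun n k lam z) (lagGen n r lam z) := by
  have h := (hasSum_lagPoly hn hr (|lam| * ‖z‖ ^ 2 / 2)).mul_right
    (Real.exp (-(|lam| * ‖z‖ ^ 2 / 4)))
  have h1 : 1 - r ≠ 0 := by have := (abs_lt.1 hr).2; linarith
  have e : ((1 - r) ^ n)⁻¹ * Real.exp (-(r * (|lam| * ‖z‖ ^ 2 / 2) / (1 - r))) *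
      Real.exp (-(|lam| * ‖z‖ ^ 2 / 4)) = lagGen n r lam z := by
    rw [lagGen, mul_assoc, ← Real.exp_add]
    congr 2
    field_simp
    ring
  rw [e] at h
  simpa only [lagFun, mul_assoc] using h

lemma abs_lagFun_le {n : ℕ} (hn : 1 ≤ n) (k : ℕ) (lam : ℝ) (z : Cn n) :
    |lagFun n k lam z| ≤ (4 / 3) ^ n * 4 ^ k * Real.exp (-(|lam| / 12 * ‖z‖ ^ 2)) := by
  set t := |lam| * ‖z‖ ^ 2 / 2 with ht
  have ht0 : 0 ≤ t := by positivity
  have h := hasSum_lagPoly hn (r := 1 / 4) (by rw [abs_of_pos] <;> norm_num) (-t)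
  have hnn : ∀ j, 0 ≤ lagPoly n j (-t) := fun j => by
    have := (abs_nonneg _).trans (abs_lagPoly_le n j t)
    rwa [abs_of_nonneg ht0] at this
  have h1 := le_hasSum h k fun j _ => mul_nonneg (by positivity) (hnn j)
  have h2 := abs_lagPoly_le n k t
  rw [abs_of_nonneg ht0] at h2
  have h3 : lagPoly n k (-t) ≤ (4 / 3) ^ n * 4 ^ k * Real.exp (t / 3) := by
    have e : ((1 - 1 / 4 : ℝ) ^ n)⁻¹ * Real.exp (-(1 / 4 * -t / (1 - 1 / 4))) =
        (4 / 3) ^ n * Real.exp (t / 3) := by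
      rw [← inv_pow]
      congr 2
      · norm_num
      · ring
    rw [e] at h1
    calc lagPoly n k (-t) = 4 ^ k * ((1 / 4) ^ k * lagPoly n k (-t)) := by
          rw [← mul_assoc, ← mul_pow]; norm_num
      _ ≤ 4 ^ k * ((4 / 3) ^ n * Real.exp (t / 3)) := by gcongr
      _ = _ := by ring
  rw [lagFun, ← ht, abs_mul, Real.abs_exp]
  calc _ ≤ ((4 / 3) ^ n * 4 ^ k * Real.exp (t / 3)) * Real.exp (-(|lam| * ‖z‖ ^ 2 / 4)) := by
        gcongr; exact h2.trans h3
    _ = _ := by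
        rw [mul_assoc, ← Real.exp_add, ht]
        congr 2
        ring

lemma norm_lagFun_le_const {n : ℕ} (hn : 1 ≤ n) (k : ℕ) (lam : ℝ) (z : Cn n) :
    ‖(lagFun n k lam z : ℂ)‖ ≤ (4 / 3) ^ n * 4 ^ k := by
  rw [Complex.norm_real, Real.norm_eq_abs]
  refine (abs_lagFun_le hn k lam z).trans (mul_le_of_le_one_right (by positivity) ?_)
  rw [Real.exp_le_one_iff, neg_nonpos]
  positivity

lemma integrable_gaussian_Cn (n : ℕ) {c : ℝ} (hc : 0 < c) :
    Integrable fun z : Cn n => Real.exp (-(c * ‖z‖ ^ 2)) := by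
  have h := (GaussianFourier.integrable_cexp_neg_mul_sq_norm_add (b := (c : ℂ)) (V := Cn n)
    (by simpa using hc) 0 0).norm
  refine h.congr (Eventually.of_forall fun z => ?_)
  simp [Complex.norm_exp, ← Complex.ofReal_pow, ← Complex.ofReal_mul]

lemma integrable_lagFun {n : ℕ} (hn : 1 ≤ n) (k : ℕ) {lam : ℝ} (hlam : lam ≠ 0) :
    Integrable fun z : Cn n => (lagFun n k lam z : ℂ) := by
  have hc : 0 < |lam| / 12 := by positivity
  refine ((integrable_gaussian_Cn n hc).const_mul ((4 / 3) ^ n * 4 ^ k)).mono'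
    (by have := continuous_lagFun n k lam; fun_prop) (Eventually.of_forall fun z => ?_)
  rw [Complex.norm_real, Real.norm_eq_abs]
  exact abs_lagFun_le hn k lam z

lemma hasSum_twConv_lagFun {n : ℕ} (hn : 1 ≤ n) {r : ℝ} (hr : |r| < 1 / 4) {lam : ℝ}
    (hlam : lam ≠ 0) (μ : ℝ) {A : Cn n → ℂ} (hA : Continuous A) {M : ℝ} (hM : ∀ w, ‖A w‖ ≤ M)
    (z : Cn n) :
    HasSum (fun k : ℕ => (r : ℂ) ^ k * twConv n μ A (fun w => (lagFun n k lam w : ℂ)) z)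
      (twConv n μ A (fun w => (lagGen n r lam w : ℂ)) z) := by
  have hc : 0 < |lam| / 12 := by positivity
  have hM0 : 0 ≤ M := (norm_nonneg _).trans (hM 0)
  set B : ℕ → Cn n → ℝ := fun k w =>
    (M * (4 / 3) ^ n * (4 * |r|) ^ k) * Real.exp (-(|lam| / 12 * ‖w‖ ^ 2)) with hB
  have hBi : ∀ k, Integrable (B k) := fun k => (integrable_gaussian_Cn n hc).const_mul _
  set F : ℕ → Cn n → ℂ := fun k w =>
    (r : ℂ) ^ k * (A (z - w) * (lagFun n k lam w : ℂ) * twPhase μ z w) with hF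
  have hFB : ∀ k w, ‖F k w‖ ≤ B k w := fun k w => by
    simp only [hF, hB, norm_mul, norm_twPhase, norm_pow, Complex.norm_real, Real.norm_eq_abs]
    calc |r| ^ k * (‖A (z - w)‖ * |lagFun n k lam w| * 1) ≤
        |r| ^ k * (M * ((4 / 3) ^ n * 4 ^ k * Real.exp (-(|lam| / 12 * ‖w‖ ^ 2))) * 1) := by
          gcongr
          · exact hM _
          · exact abs_lagFun_le hn k lam w
      _ = _ := by rw [mul_pow]; ring
  have hFi : ∀ k, Integrable (F k) := fun k => by
    refine (hBi k).mono' ?_ (Eventually.of_forall (hFB k))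
    have h1 := continuous_lagFun n k lam
    have h2 := continuous_twPhase μ (continuous_const (y := z)) (continuous_id (X := Cn n))
    simp only [id_eq] at h2
    exact Continuous.aestronglyMeasurable (by fun_prop)
  have hs : Summable fun k => ∫ w, ‖F k w‖ := by
    have hg : Summable fun k : ℕ => (4 * |r|) ^ k *
        (M * (4 / 3) ^ n * ∫ w : Cn n, Real.exp (-(|lam| / 12 * ‖w‖ ^ 2))) :=
      (summable_geometric_of_lt_one (by positivity) (by linarith)).mul_right _
    refine Summable.of_nonneg_of_le (fun k => integral_nonneg fun w => norm_nonneg _)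
      (fun k => ?_) hg
    refine (integral_mono (hFi k).norm (hBi k) (hFB k)).trans (le_of_eq ?_)
    rw [hB, integral_const_mul]
    ring
  have h := hasSum_integral_of_summable_integral_norm hFi hs
  have h1 : ∀ k, ∫ w, F k w =
      (r : ℂ) ^ k * twConv n μ A (fun w => (lagFun n k lam w : ℂ)) z := fun k => by
    rw [twConv_eq, ← integral_const_mul]
  have h2 : ∫ w, ∑' k, F k w = twConv n μ A (fun w => (lagGen n r lam w : ℂ)) z := by
    rw [twConv_eq]
    congr 1
    ext w
    have h3 := Complex.hasSum_ofReal.2 (hasSum_lagFun hn (hr.trans (by norm_num)) lam w)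
    have h4 := (h3.mul_left (A (z - w))).mul_right (twPhase μ z w)
    rw [← h4.tsum_eq]
    congr 1
    ext k
    simp only [hF]
    push_cast
    ring
  simp only [h1, h2] at h
  exact h

lemma twConv_lagGen {n : ℕ} {r s : ℝ} (hr : |r| < 1 / 4) (hs : |s| < 1 / 4) {lam μ : ℝ}
    (hlam : lam ≠ 0) (hμ : μ ^ 2 = lam ^ 2) (z : Cn n) :
    twConv n μ (fun w => (lagGen n r lam w : ℂ)) (fun w => (lagGen n s lam w : ℂ)) z =
      (((2 * π) / |lam|) ^ n * lagGen n (r * s) lam z : ℝ) := by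
  have hr1 := one_sub_pos_of_abs_lt_quarter hr
  have hs1 := one_sub_pos_of_abs_lt_quarter hs
  have hrs1 : 0 < 1 - r * s := by
    refine one_sub_pos_of_abs_lt_quarter ?_
    rw [abs_mul]
    nlinarith [abs_nonneg r, abs_nonneg s]
  have hr2 : 0 < 1 + r := by have := (abs_lt.1 hr).1; linarith
  have hs2 : 0 < 1 + s := by have := (abs_lt.1 hs).1; linarith
  have hl : 0 < |lam| := abs_pos.2 hlam
  have hg := twConv_gaussian (n := n) (a := (1 + r) / (1 - r) * (|lam| / 4))
    (b := (1 + s) / (1 - s) * (|lam| / 4)) (by positivity) μ z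
  have hpull : twConv n μ (fun w => (lagGen n r lam w : ℂ)) (fun w => (lagGen n s lam w : ℂ)) z =
      ((((1 - r) ^ n)⁻¹ * ((1 - s) ^ n)⁻¹ : ℝ) : ℂ) *
        twConv n μ (fun w => (Real.exp (-((1 + r) / (1 - r) * (|lam| / 4) * ‖w‖ ^ 2)) : ℂ))
          (fun w => (Real.exp (-((1 + s) / (1 - s) * (|lam| / 4) * ‖w‖ ^ 2)) : ℂ)) z := by
    rw [twConv_eq, twConv_eq, ← integral_const_mul]
    congr 1
    ext w
    simp only [lagGen, Complex.ofReal_mul]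
    ring
  rw [hpull, hg, ← Complex.ofReal_mul]
  congr 1
  have hsum : (1 + r) / (1 - r) * (|lam| / 4) + (1 + s) / (1 - s) * (|lam| / 4) =
      |lam| * (1 - r * s) / (2 * ((1 - r) * (1 - s))) := by
    field_simp
    ring
  have hexp : ((1 + r) / (1 - r) * (|lam| / 4) * ((1 + s) / (1 - s) * (|lam| / 4)) + μ ^ 2 / 16) /
      (|lam| * (1 - r * s) / (2 * ((1 - r) * (1 - s)))) =
      (1 + r * s) / (1 - r * s) * (|lam| / 4) := by
    rw [hμ, ← sq_abs lam]
    field_simp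
    ring
  rw [hsum, hexp, lagGen]
  simp only [div_pow, mul_pow]
  field_simp

lemma norm_lagGen_le {n : ℕ} {r : ℝ} (hr : |r| < 1 / 4) (lam : ℝ) (w : Cn n) :
    ‖(lagGen n r lam w : ℂ)‖ ≤ ((1 - r) ^ n)⁻¹ := by
  have hr1 := one_sub_pos_of_abs_lt_quarter hr
  have hr2 : 0 < 1 + r := by have := (abs_lt.1 hr).1; linarith
  rw [Complex.norm_real, lagGen, norm_mul, Real.norm_of_nonneg (by positivity),
    Real.norm_of_nonneg (by positivity)]
  refine mul_le_of_le_one_right (by positivity) ?_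
  rw [Real.exp_le_one_iff, neg_nonpos]
  positivity

lemma twConv_lagGen_lagFun {n : ℕ} (hn : 1 ≤ n) {r : ℝ} (hr : |r| < 1 / 4) (k : ℕ) {lam μ : ℝ}
    (hlam : lam ≠ 0) (hμ : μ ^ 2 = lam ^ 2) (z : Cn n) :
    twConv n μ (fun w => (lagGen n r lam w : ℂ)) (fun w => (lagFun n k lam w : ℂ)) z =
      (((2 * π) / |lam|) ^ n * (r ^ k * lagFun n k lam z) : ℝ) := by
  refine congrFun (eq_of_hasSum_pow_mul (ρ := 1 / 4) (by norm_num)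
    (a := fun k => twConv n μ (fun w => (lagGen n r lam w : ℂ)) (fun w => (lagFun n k lam w : ℂ)) z)
    (b := fun k => ((((2 * π) / |lam|) ^ n * (r ^ k * lagFun n k lam z) : ℝ) : ℂ))
    (fun s hs => hasSum_twConv_lagFun hn hs hlam μ
      (by unfold lagGen; fun_prop) (norm_lagGen_le hr lam) z) (fun s hs => ?_)) k
  rw [twConv_lagGen hr hs hlam hμ]
  have hrs : |r * s| < 1 := by
    rw [abs_mul]
    nlinarith [abs_nonneg r, abs_nonneg s]
  have h := Complex.hasSum_ofReal.2
    ((hasSum_lagFun hn hrs lam z).mul_left (((2 * π) / |lam|) ^ n))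
  convert! h using 2 with j
  push_cast
  ring

/-- Laguerre functions of the same index reproduce under twisted convolution. -/
lemma twConv_lagFun_lagFun {n : ℕ} (hn : 1 ≤ n) (k : ℕ) {lam μ : ℝ}
    (hlam : lam ≠ 0) (hμ : μ ^ 2 = lam ^ 2) (z : Cn n) :
    twConv n μ (fun w => (lagFun n k lam w : ℂ)) (fun w => (lagFun n k lam w : ℂ)) z =
      (((2 * π) / |lam|) ^ n * lagFun n k lam z : ℝ) := by
  have h := congrFun (eq_of_hasSum_pow_mul (ρ := 1 / 4) (by norm_num)
    (a := fun j => twConv n μ (fun w => (lagFun n k lam w : ℂ)) (fun w => (lagFun n j lam w : ℂ)) z)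
    (b := fun j => if j = k then ((((2 * π) / |lam|) ^ n * lagFun n k lam z : ℝ) : ℂ) else 0)
    (fun s hs => hasSum_twConv_lagFun hn hs hlam μ
      (by have := continuous_lagFun n k lam; fun_prop) (norm_lagFun_le_const hn k lam) z)
    (fun s hs => ?_)) k
  · simpa using h
  · rw [twConv_comm, twConv_lagGen_lagFun hn hs k hlam (by rwa [neg_sq])]
    have h1 := hasSum_ite_eq k
      ((((2 * π) / |lam|) ^ n * (s ^ k * lagFun n k lam z) : ℝ) : ℂ)
    convert! h1 using 2 with j
    split_ifs with hj
    · subst hj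
      push_cast
      ring
    · simp

lemma integrable_fLam {n : ℕ} {f : Hn n → ℂ} (hf : Integrable f (volume : Measure (Hn n)))
    (lam : ℝ) : Integrable (fLam n f lam) := by
  have h : Integrable (fun p : Cn n × ℝ => cexp (I * (lam : ℂ) * (p.2 : ℂ)) * f p)
      ((volume : Measure (Cn n)).prod volume) := by
    refine Integrable.bdd_mul (c := 1) hf ?_ (Eventually.of_forall fun p => ?_)
    · exact Continuous.aestronglyMeasurable (by fun_prop)
    · rw [show I * (lam : ℂ) * (p.2 : ℂ) = ((lam * p.2 : ℝ) : ℂ) * I by push_cast; ring,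
        Complex.norm_exp_ofReal_mul_I]
  exact h.integral_prod_left

lemma twPhase_mul_twPhase {n : ℕ} (μ : ℝ) (z u w : Cn n) :
    twPhase μ (w + u) u * twPhase μ z (w + u) = twPhase μ z u * twPhase μ (z - u) w := by
  simp only [twPhase, ← Complex.exp_add, imZW_add_left, imZW_add_right, imZW_sub_left, imZW_self,
    imZW_swap u w]
  congr 1
  push_cast
  ring

/-- Associativity of the twisted convolution of two integrable functions and a bounded
continuous one. -/
lemma integral_twConv_mul_eq {n : ℕ} (μ : ℝ) {F G K : Cn n → ℂ} (hF : Integrable F)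
    (hG : Integrable G) (hK : Continuous K) {M : ℝ} (hM : ∀ w, ‖K w‖ ≤ M) (z : Cn n) :
    ∫ w, twConv n (-μ) F G w * K (z - w) * twPhase μ z w =
      ∫ u, F u * twPhase μ z u * twConv n μ K G (z - u) := by
  have h1 : ∀ w, twConv n (-μ) F G w * K (z - w) * twPhase μ z w =
      ∫ u, F u * G (w - u) * (twPhase μ w u * (K (z - w) * twPhase μ z w)) := by
    intro w
    rw [twConv_comm, neg_neg, twConv_eq, mul_assoc, ← integral_mul_const]
    congr 1
    ext u
    ring
  simp only [h1]
  rw [integral_integral_swap]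
  · congr 1
    ext u
    rw [← integral_add_right_eq_self _ u, twConv_eq, ← integral_const_mul]
    congr 1
    ext w
    have h2 := twPhase_mul_twPhase μ z u w
    rw [add_sub_cancel_right, show z - (w + u) = z - u - w by abel]
    linear_combination (F u * G w * K (z - u - w)) * h2
  · have h := hF.convolution_integrand (ContinuousLinearMap.mul ℂ ℂ) hG
    refine Integrable.mul_bdd (c := M) h ?_ (Eventually.of_forall fun p => ?_)
    · have h3 := continuous_twPhase μ (continuous_fst (X := Cn n) (Y := Cn n)) continuous_snd
      have h4 := continuous_twPhase μ (continuous_const (y := z))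
        (continuous_fst (X := Cn n) (Y := Cn n))
      exact Continuous.aestronglyMeasurable (by fun_prop)
    · simpa [norm_twPhase] using hM _

/-- The Strichartz Fourier transform satisfies the compatibility (reproducing) identity
(2π)^{−n}|λ|^n ∫ f̂(a,w) φ_{k,λ}(z−w) e^{(i/2)λIm(z·w̄)} dw = f̂(a,z) on each ray R_k. -/
theorem strichartz_compatibility (n : ℕ) (hn : 1 ≤ n) (f : Hn n → ℂ)
    (hf : Integrable f (volume : Measure (Hn n))) (k : ℕ) (lam : ℝ) (hlam : lam ≠ 0)
    (z : Cn n) :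
    (((((2 * π) ^ n)⁻¹ * |lam| ^ n : ℝ)) : ℂ) *
      ∫ w : Cn n, stri n f k lam w * ((lagFun n k lam (z - w) : ℝ) : ℂ) *
        Complex.exp (Complex.I / 2 * (lam : ℂ) * ((imZW z w : ℝ) : ℂ)) =
      stri n f k lam z := by
  have hcont := continuous_lagFun n k lam
  have h := integral_twConv_mul_eq lam (integrable_fLam hf (-lam)) (integrable_lagFun hn k hlam)
    (K := fun w => (lagFun n k lam w : ℂ)) (by fun_prop) (norm_lagFun_le_const hn k lam) z
  have hl : |lam| ≠ 0 := abs_ne_zero.2 hlam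
  simp only [stri]
  refine (congrArg _ h).trans ?_
  rw [twConv_comm, neg_neg, twConv_eq, ← integral_const_mul]
  congr 1
  ext u
  rw [twConv_lagFun_lagFun hn k hlam rfl]
  have hc : ((((2 * π) ^ n)⁻¹ * |lam| ^ n : ℝ) : ℂ) * (((2 * π / |lam|) ^ n : ℝ) : ℂ) = 1 := by
    rw [← Complex.ofReal_mul, ← Complex.ofReal_one]
    congr 1
    rw [div_pow]
    field_simp
  rw [Complex.ofReal_mul ((2 * π / |lam|) ^ n)]
  linear_combination (fLam n f (-lam) u * twPhase lam z u * lagFun n k lam (z - u)) * hc
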